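/- Let σ > 0 and P > 0, let μ_H be the standard circularly-symmetric complex Gaussian measure on ℂ (modeling the sensing fading coefficient H_s), and let μ be a π/2-symmetric probability measure on ℂ concentrated on the circle of radius √P. Then the sensing mutual information expression, I_s = ∫ ∑_{l=0}^{3} ξ(∫ W_σ(y_l, h·x) dμ_H(h)) dμ(x) − ∫∫ ∑_{l=0}^{3} ξ(W_σ(y_l, h·x)) dμ_H(h) dμ(x), equals the closed form I_s = 2 − ∫ [ H_b(Q(√(2P)·|Re h|/σ)) + H_b(Q(√(2P)·|Im h|/σ)) ] dμ_H(h); in particular it coincides with the communication capacity expression evaluated with the same σ and P, so the same input distribution simultaneously attains both the communication and sensing capacities. -/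

import Mathlib

open MeasureTheory ProbabilityTheory

/-- Standard Gaussian tail function. -/
noncomputable def Qtail (x : ℝ) : ℝ := ((gaussianReal 0 1) (Set.Ioi x)).toReal

/-- 1-bit quantizer output points `y_l = i^l * (1 + i)`. -/
noncomputable def ypt (l : ℕ) : ℂ := Complex.I ^ l * (1 + Complex.I)

/-- 1-bit I/Q channel law. -/
noncomputable def Wlaw (σ : ℝ) (l : ℕ) (z : ℂ) : ℝ :=
  Qtail (-(z.re * (ypt l).re) / (σ / Real.sqrt 2)) *
  Qtail (-(z.im * (ypt l).im) / (σ / Real.sqrt 2))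

/-- `ξ x = -x * log₂ x` (with `ξ 0 = 0`). -/
noncomputable def xi (x : ℝ) : ℝ := -x * Real.logb 2 x

/-- Binary entropy function in bits. -/
noncomputable def Hb (p : ℝ) : ℝ := xi p + xi (1 - p)

/-- Standard circularly-symmetric complex Gaussian measure on ℂ. -/
noncomputable def muH : Measure ℂ :=
  Measure.map (fun p : ℝ × ℝ => (p.1 : ℂ) + (p.2 : ℂ) * Complex.I)
    ((gaussianReal 0 (1/2)).prod (gaussianReal 0 (1/2)))

lemma Qtail_antitone : Antitone Qtail := by
  intro a b hab
  unfold Qtail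
  exact ENNReal.toReal_mono (measure_ne_top _ _) (measure_mono (Set.Ioi_subset_Ioi hab))

lemma Qtail_measurable : Measurable Qtail := Qtail_antitone.measurable

lemma Qtail_nonneg (x : ℝ) : 0 ≤ Qtail x := ENNReal.toReal_nonneg

lemma Qtail_le_one (x : ℝ) : Qtail x ≤ 1 := by
  unfold Qtail
  exact ENNReal.toReal_le_of_le_ofReal zero_le_one (by simpa using prob_le_one)

lemma Qtail_neg (x : ℝ) : Qtail (-x) = 1 - Qtail x := by
  have h1 : (gaussianReal 0 1) (Set.Ioi (-x)) = (gaussianReal 0 1) (Set.Iio x) := by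
    have h := gaussianReal_map_neg (μ := 0) (v := 1)
    rw [neg_zero] at h
    conv_lhs => rw [← h]
    rw [Measure.map_apply measurable_neg measurableSet_Ioi]
    congr 1
    ext y; simp
  have : NullSingletonClass (gaussianReal 0 1) := nullSingletonClass_gaussianReal one_ne_zero
  have h2 : (gaussianReal 0 1) (Set.Iio x) = (gaussianReal 0 1) (Set.Ioi x)ᶜ := by
    rw [Set.compl_Ioi]
    exact measure_congr Iio_ae_eq_Iic
  unfold Qtail
  rw [h1, h2]
  exact probReal_compl_eq_one_sub (μ := gaussianReal 0 1) measurableSet_Ioi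

lemma Hb_symm (p : ℝ) : Hb (1 - p) = Hb p := by
  unfold Hb; rw [sub_sub_cancel, add_comm]

lemma Hb_Qtail_abs (a : ℝ) : Hb (Qtail |a|) = Hb (Qtail a) := by
  rcases abs_choice a with h | h <;> rw [h]
  rw [Qtail_neg, Hb_symm]

lemma xi_mul (p q : ℝ) : xi (p * q) = p * xi q + q * xi p := by
  unfold xi
  rcases eq_or_ne p 0 with rfl | hp
  · simp
  rcases eq_or_ne q 0 with rfl | hq
  · simp
  rw [Real.logb_mul hp hq]; ring

lemma xi_quarter : xi (1 / 4) = 1 / 2 := by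
  unfold xi
  have : Real.logb 2 (1 / 4) = -2 := by
    rw [Real.logb_eq_iff_rpow_eq (by norm_num) (by norm_num) (by norm_num)]
    rw [Real.rpow_neg (by norm_num)]; norm_num
  rw [this]; norm_num

lemma ypt0 : (ypt 0).re = 1 ∧ (ypt 0).im = 1 := by simp [ypt]
lemma ypt1 : (ypt 1).re = -1 ∧ (ypt 1).im = 1 := by simp [ypt]
lemma ypt2 : (ypt 2).re = -1 ∧ (ypt 2).im = -1 := by simp [ypt]
lemma ypt3 : (ypt 3).re = 1 ∧ (ypt 3).im = -1 := by simp [ypt, pow_succ]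

lemma W0 (σ : ℝ) (z : ℂ) : Wlaw σ 0 z =
    (1 - Qtail (z.re / (σ / √2))) * (1 - Qtail (z.im / (σ / √2))) := by
  rw [← Qtail_neg, ← Qtail_neg, Wlaw, ypt0.1, ypt0.2]; simp [neg_div]
lemma W1 (σ : ℝ) (z : ℂ) : Wlaw σ 1 z =
    (Qtail (z.re / (σ / √2))) * (1 - Qtail (z.im / (σ / √2))) := by
  rw [← Qtail_neg, Wlaw, ypt1.1, ypt1.2]; simp [neg_div]
lemma W2 (σ : ℝ) (z : ℂ) : Wlaw σ 2 z =
    (Qtail (z.re / (σ / √2))) * (Qtail (z.im / (σ / √2))) := by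
  rw [Wlaw, ypt2.1, ypt2.2]; simp
lemma W3 (σ : ℝ) (z : ℂ) : Wlaw σ 3 z =
    (1 - Qtail (z.re / (σ / √2))) * (Qtail (z.im / (σ / √2))) := by
  rw [← Qtail_neg, Wlaw, ypt3.1, ypt3.2]; simp [neg_div]

lemma sum_W (σ : ℝ) (z : ℂ) : Wlaw σ 0 z + Wlaw σ 1 z + Wlaw σ 2 z + Wlaw σ 3 z = 1 := by
  rw [W0, W1, W2, W3]; ring

lemma sum_xi_W (σ : ℝ) (z : ℂ) : ∑ l ∈ Finset.range 4, xi (Wlaw σ l z) =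
    Hb (Qtail (z.re / (σ / √2))) + Hb (Qtail (z.im / (σ / √2))) := by
  simp only [Finset.sum_range_succ, Finset.sum_range_zero]
  rw [W0, W1, W2, W3]
  simp only [xi_mul, Hb]; ring

lemma W_meas (σ : ℝ) (l : ℕ) : Measurable (Wlaw σ l) := by
  unfold Wlaw
  exact (Qtail_measurable.comp (by fun_prop)).mul (Qtail_measurable.comp (by fun_prop))

lemma muH_map_meas :
    Measurable (fun p : ℝ × ℝ => (p.1 : ℂ) + (p.2 : ℂ) * Complex.I) := by fun_prop

instance muH_prob : IsProbabilityMeasure muH :=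
  Measure.isProbabilityMeasure_map muH_map_meas.aemeasurable

lemma charFun_muH (t : ℂ) : charFun muH t = Complex.exp (-(‖t‖ ^ 2 : ℝ) / 4) := by
  rw [charFun_apply, muH, integral_map muH_map_meas.aemeasurable
    (Measurable.aestronglyMeasurable (by fun_prop))]
  have : ∀ p : ℝ × ℝ, Complex.exp ((inner ℝ ((p.1 : ℂ) + (p.2 : ℂ) * Complex.I) t : ℝ) * Complex.I)
      = Complex.exp (t.re * p.1 * Complex.I) * Complex.exp (t.im * p.2 * Complex.I) := by
    intro p
    rw [← Complex.exp_add]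
    congr 1
    simp [Complex.inner]
    ring
  simp_rw [this]
  rw [integral_prod_mul (fun x : ℝ => Complex.exp (t.re * x * Complex.I))
    (fun x : ℝ => Complex.exp (t.im * x * Complex.I)), ← charFun_apply_real, ← charFun_apply_real,
    charFun_gaussianReal, charFun_gaussianReal, ← Complex.exp_add]
  congr 1
  rw [← Complex.normSq_eq_norm_sq, Complex.normSq_apply]
  push_cast
  simp
  ring

lemma muH_rot (u : ℂ) (hu : ‖u‖ = 1) : muH.map (fun h => h * u) = muH := by
  have hm : Measurable (fun h : ℂ => h * u) := by fun_prop
  have : IsProbabilityMeasure (muH.map (fun h => h * u)) :=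
    Measure.isProbabilityMeasure_map hm.aemeasurable
  apply Measure.ext_of_charFun
  ext t
  have h1 : charFun (muH.map (fun h => h * u)) t = charFun muH (t * (starRingEnd ℂ) u) := by
    rw [charFun_apply, charFun_apply, integral_map hm.aemeasurable
      (Measurable.aestronglyMeasurable (by fun_prop))]
    congr 1
    ext h
    congr 3
    simp [Complex.inner]
    ring
  rw [h1, charFun_muH, charFun_muH]
  simp [hu]

lemma int_rot (P : ℝ) (hP : 0 < P) (x : ℂ) (hx : ‖x‖ = √P) (F : ℂ → ℝ) (hF : Measurable F) :
    ∫ h, F (h * x) ∂muH = ∫ h, F (h * (√P : ℝ)) ∂muH := by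
  have hs : (√P) ≠ 0 := (Real.sqrt_pos.2 hP).ne'
  have hsc : ((√P : ℝ) : ℂ) ≠ 0 := by exact_mod_cast hs
  have hu : ‖x / (√P : ℝ)‖ = 1 := by
    rw [norm_div, hx, Complex.norm_real, Real.norm_of_nonneg (Real.sqrt_nonneg _), div_self hs]
  conv_rhs => rw [← muH_rot _ hu]
  have hG : Measurable (fun h : ℂ => F (h * (√P : ℝ))) := hF.comp (by fun_prop)
  rw [integral_map (Measurable.aemeasurable (by fun_prop)) hG.aestronglyMeasurable]
  congr 1
  ext h
  congr 1
  field_simp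

lemma W_integrable (σ : ℝ) (l : ℕ) (c : ℂ) : Integrable (fun h => Wlaw σ l (h * c)) muH := by
  refine Integrable.of_bound (C := 1)
    ((W_meas σ l).comp (by fun_prop)).aestronglyMeasurable (ae_of_all _ fun h => ?_)
  unfold Wlaw
  rw [Real.norm_of_nonneg (mul_nonneg (Qtail_nonneg _) (Qtail_nonneg _))]
  exact mul_le_one₀ (Qtail_le_one _) (Qtail_nonneg _) (Qtail_le_one _)

lemma W_succ (σ : ℝ) (l : ℕ) (z : ℂ) : Wlaw σ (l + 1) (Complex.I * z) = Wlaw σ l z := by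
  unfold Wlaw
  have : ypt (l + 1) = Complex.I * ypt l := by unfold ypt; ring
  rw [this]
  simp
  ring

lemma int_W_succ (σ P : ℝ) (hP : 0 < P) (l : ℕ) (x : ℂ) (hx : ‖x‖ = √P) :
    ∫ h, Wlaw σ (l + 1) (h * x) ∂muH = ∫ h, Wlaw σ l (h * x) ∂muH := by
  rw [int_rot P hP x hx _ (W_meas σ (l + 1)),
    ← int_rot P hP (Complex.I * x) (by simp [hx]) _ (W_meas σ (l + 1))]
  congr 1
  ext h
  rw [← W_succ σ l (h * x)]
  congr 1
  ring

lemma int_W (σ P : ℝ) (hP : 0 < P) (x : ℂ) (hx : ‖x‖ = √P) :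
    ∑ l ∈ Finset.range 4, xi (∫ h, Wlaw σ l (h * x) ∂muH) = 2 := by
  have e1 := int_W_succ σ P hP 0 x hx
  have e2 := int_W_succ σ P hP 1 x hx
  have e3 := int_W_succ σ P hP 2 x hx
  norm_num at e1 e2 e3
  have hs : ∫ h, (Wlaw σ 0 (h * x) + Wlaw σ 1 (h * x) + Wlaw σ 2 (h * x) + Wlaw σ 3 (h * x)) ∂muH
      = 1 := by
    simp [sum_W]
  have i0 := W_integrable σ 0 x
  have i1 := W_integrable σ 1 x
  have i2 := W_integrable σ 2 x
  have i3 := W_integrable σ 3 x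
  have i01 : Integrable (fun h => Wlaw σ 0 (h * x) + Wlaw σ 1 (h * x)) muH := i0.add i1
  have i012 : Integrable (fun h => Wlaw σ 0 (h * x) + Wlaw σ 1 (h * x) + Wlaw σ 2 (h * x)) muH :=
    i01.add i2
  rw [integral_add i012 i3, integral_add i01 i2, integral_add i0 i1,
    e3, e2, e1] at hs
  have h0 : ∫ h, Wlaw σ 0 (h * x) ∂muH = 1 / 4 := by linarith
  simp only [Finset.sum_range_succ, Finset.sum_range_zero]
  rw [e3, e2, e1, h0, xi_quarter]; norm_num

theorem stmt15 (σ P : ℝ) (hσ : 0 < σ) (hP : 0 < P)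
    (μ : Measure ℂ) [IsProbabilityMeasure μ]
    (hsym : Measure.map (fun x : ℂ => Complex.I * x) μ = μ)
    (hcirc : μ {x : ℂ | ‖x‖ = Real.sqrt P} = 1) :
    (∫ x, ∑ l ∈ Finset.range 4, xi (∫ h, Wlaw σ l (h * x) ∂muH) ∂μ)
        - ∫ x, ∫ h, ∑ l ∈ Finset.range 4, xi (Wlaw σ l (h * x)) ∂muH ∂μ
      = 2 - ∫ h, (Hb (Qtail (Real.sqrt (2 * P) * |h.re| / σ))
            + Hb (Qtail (Real.sqrt (2 * P) * |h.im| / σ))) ∂muH := by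
  have hae : ∀ᵐ x ∂μ, ‖x‖ = √P := by
    have hm : MeasurableSet {x : ℂ | ‖x‖ = √P} := measurableSet_eq_fun (by fun_prop) (by fun_prop)
    exact (prob_compl_eq_zero_iff hm).2 hcirc
  have h1 : (∫ x, ∑ l ∈ Finset.range 4, xi (∫ h, Wlaw σ l (h * x) ∂muH) ∂μ) = 2 := by
    rw [integral_congr_ae (g := fun _ => (2 : ℝ))]
    · simp
    · filter_upwards [hae] with x hx using int_W σ P hP x hx
  have hxi : Measurable xi := by
    unfold xi
    exact measurable_neg.mul (by unfold Real.logb; fun_prop)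
  have hF : Measurable (fun z => ∑ l ∈ Finset.range 4, xi (Wlaw σ l z)) :=
    Finset.measurable_sum _ fun l _ => hxi.comp (W_meas σ l)
  have habs : ∀ r : ℝ, √(2 * P) * |r| / σ = |r * √P / (σ / √2)| := by
    intro r
    rw [abs_div, abs_mul, abs_of_nonneg (Real.sqrt_nonneg P),
      abs_of_pos (a := σ / √2) (by positivity), Real.sqrt_mul (by norm_num)]
    field_simp
  have h2 : ∀ᵐ x ∂μ, ∫ h, ∑ l ∈ Finset.range 4, xi (Wlaw σ l (h * x)) ∂muH =
      ∫ h, (Hb (Qtail (Real.sqrt (2 * P) * |h.re| / σ))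
            + Hb (Qtail (Real.sqrt (2 * P) * |h.im| / σ))) ∂muH := by
    filter_upwards [hae] with x hx
    rw [int_rot P hP x hx _ hF]
    congr 1
    ext h
    rw [sum_xi_W, habs, habs, Hb_Qtail_abs, Hb_Qtail_abs]
    simp
  rw [h1, integral_congr_ae h2]
  simp
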